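/- arXiv:1603.07243 — 5 statements merged into one kernel-verified Lean document; each statement's English description precedes it below -/
import Mathlib

section
/- Let G be a finite simple graph, k a positive integer, and v a vertex of G. Then γ_{P,k}(G − v) ≥ γ_{P,k}(G) − 1, where G − v is the graph obtained from G by deleting v and all its incident edges. -/
open SimpleGraph

variable {V : Type*}

/-- The closed neighbourhood `N_G[v]` of a vertex. -/
def closedNbhd (G : SimpleGraph V) (v : V) : Set V := insert v (G.neighborSet v)

/-- The closed neighbourhood `N_G[X]` of a set of vertices. -/
def closedNbhdSet (G : SimpleGraph V) (X : Set V) : Set V := ⋃ v ∈ X, closedNbhd G v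

/-- The sets `P^i_{G,k}(S)` of vertices monitored by `S` at step `i`. -/
def monitored (G : SimpleGraph V) (k : ℕ) (S : Set V) : ℕ → Set V
  | 0 => closedNbhdSet G S
  | i + 1 =>
      ⋃ v ∈ {w | w ∈ monitored G k S i ∧ (closedNbhd G w \ monitored G k S i).ncard ≤ k},
        closedNbhd G v

/-- `S` is a `k`-power dominating set of `G`. -/
def IsPDS (G : SimpleGraph V) (k : ℕ) (S : Set V) : Prop :=
  ∃ i, monitored G k S i = Set.univ

/-- The `k`-power domination number `γ_{P,k}(G)`. -/
noncomputable def pdn (G : SimpleGraph V) (k : ℕ) : ℕ :=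
  sInf {n | ∃ S : Set V, IsPDS G k S ∧ S.ncard = n}

/-- The radius `rad_{P,k}(G,S)` of a `k`-PDS `S`. -/
noncomputable def radPDS (G : SimpleGraph V) (k : ℕ) (S : Set V) : ℕ :=
  1 + sInf {i | monitored G k S i = Set.univ}

/-- The `k`-propagation radius `rad_{P,k}(G)`. -/
noncomputable def propRad (G : SimpleGraph V) (k : ℕ) : ℕ :=
  sInf {r | ∃ S : Set V, IsPDS G k S ∧ S.ncard = pdn G k ∧ radPDS G k S = r}

/-- Adding the deleted vertex to a set monitors, at every step, its closed neighbourhood and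
everything that the set monitors in the vertex-deleted graph. -/
theorem monitored_induce_ne_subset [Finite V] (G : SimpleGraph V) (k : ℕ) (v : V)
    (S : Set {u | u ≠ v}) (i : ℕ) :
    closedNbhd G v ⊆ monitored G k (insert v (Subtype.val '' S)) i ∧
      Subtype.val '' monitored (G.induce {u | u ≠ v}) k S i ⊆
        monitored G k (insert v (Subtype.val '' S)) i := by
  have image_nbhd : ∀ w : {u | u ≠ v}, ∀ x ∈ closedNbhd (G.induce {u | u ≠ v}) w,
      x.val ∈ closedNbhd G w.val := by
    rintro w x (rfl | h)
    · exact Or.inl rfl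
    · exact Or.inr h
  induction i with
  | zero =>
    constructor
    · exact Set.subset_biUnion_of_mem (u := closedNbhd G) (Set.mem_insert v _)
    · rintro _ ⟨x, hx, rfl⟩
      obtain ⟨w, hw, hxw⟩ := Set.mem_iUnion₂.1 hx
      exact Set.mem_iUnion₂.2
        ⟨w.val, Set.mem_insert_of_mem _ (Set.mem_image_of_mem _ hw), image_nbhd w x hxw⟩
  | succ i ih =>
    obtain ⟨hv, hS⟩ := ih
    have hvi := hv (Set.mem_insert v _)
    constructor
    · refine Set.subset_biUnion_of_mem (u := closedNbhd G) ⟨hvi, ?_⟩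
      rw [Set.sdiff_eq_empty.2 hv, Set.ncard_empty]
      exact Nat.zero_le k
    · rintro _ ⟨x, hx, rfl⟩
      obtain ⟨w, ⟨hw, hk⟩, hxw⟩ := Set.mem_iUnion₂.1 hx
      refine Set.mem_iUnion₂.2
        ⟨w.val, ⟨hS (Set.mem_image_of_mem _ hw), le_trans ?_ hk⟩, image_nbhd w x hxw⟩
      rw [← Set.ncard_image_of_injective _ Subtype.val_injective]
      refine Set.ncard_le_ncard ?_ (Set.toFinite _)
      rintro y ⟨hy, hyi⟩
      have hyv : y ≠ v := fun h => hyi (h ▸ hvi)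
      refine ⟨⟨y, hyv⟩, ⟨?_, fun h => hyi (hS ⟨_, h, rfl⟩)⟩, rfl⟩
      rcases hy with hy | hy
      · exact Or.inl (Subtype.ext hy)
      · exact Or.inr hy

/-- The set of all vertices is a `k`-power dominating set. -/
theorem isPDS_univ (G : SimpleGraph V) (k : ℕ) : IsPDS G k Set.univ :=
  ⟨0, Set.eq_univ_of_forall fun x =>
    Set.mem_iUnion₂.2 ⟨x, Set.mem_univ x, Set.mem_insert x _⟩⟩

theorem pdn_vertex_deletion_lower {V : Type*} [Fintype V]
    (G : SimpleGraph V) (k : ℕ) (hk : 0 < k) (v : V) :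
    pdn G k ≤ pdn (G.induce {u | u ≠ v}) k + 1 := by
  obtain ⟨S, ⟨i, hi⟩, hS⟩ : ∃ S : Set {u | u ≠ v},
      IsPDS (G.induce {u | u ≠ v}) k S ∧ S.ncard = pdn (G.induce {u | u ≠ v}) k :=
    Nat.sInf_mem (s := {n | ∃ S : Set {u | u ≠ v}, IsPDS (G.induce {u | u ≠ v}) k S ∧ S.ncard = n})
      ⟨_, Set.univ, isPDS_univ _ k, rfl⟩
  obtain ⟨hv, hsub⟩ := monitored_induce_ne_subset G k v S i
  have hpds : IsPDS G k (insert v (Subtype.val '' S)) := by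
    refine ⟨i, Set.eq_univ_of_forall fun x => ?_⟩
    by_cases hx : x = v
    · exact hv (Or.inl hx)
    · have hx' : (⟨x, hx⟩ : {u | u ≠ v}) ∈ monitored (G.induce {u | u ≠ v}) k S i :=
        hi ▸ Set.mem_univ _
      exact hsub (Set.mem_image_of_mem _ hx')
  calc pdn G k ≤ (insert v (Subtype.val '' S)).ncard := Nat.sInf_le ⟨_, hpds, rfl⟩
    _ ≤ (Subtype.val '' S).ncard + 1 := Set.ncard_insert_le _ _
    _ = pdn (G.induce {u | u ≠ v}) k + 1 := by
      rw [Set.ncard_image_of_injective _ Subtype.val_injective, hS]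
end

section
/- Let G be a finite simple graph, k a positive integer, and e an edge of G. Then γ_{P,k}(G − e) ≤ γ_{P,k}(G) + 1, where G − e is the graph obtained from G by removing the edge e. -/
open SimpleGraph

variable {V : Type*}

theorem self_mem_closedNbhd (G : SimpleGraph V) (v : V) : v ∈ closedNbhd G v :=
  Set.mem_insert v _

theorem subset_monitored_zero (G : SimpleGraph V) (k : ℕ) (S : Set V) :
    S ⊆ monitored G k S 0 :=
  fun v hv => Set.mem_biUnion hv (self_mem_closedNbhd G v)

theorem closedNbhd_subset_monitored_zero (G : SimpleGraph V) (k : ℕ) {S : Set V} {v : V}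
    (hv : v ∈ S) : closedNbhd G v ⊆ monitored G k S 0 :=
  Set.subset_biUnion_of_mem (u := closedNbhd G) hv

theorem closedNbhd_subset_monitored_succ (G : SimpleGraph V) (k : ℕ) {S : Set V} {i : ℕ} {v : V}
    (hv : v ∈ monitored G k S i) (hk : (closedNbhd G v \ monitored G k S i).ncard ≤ k) :
    closedNbhd G v ⊆ monitored G k S (i + 1) :=
  Set.subset_biUnion_of_mem (u := closedNbhd G)
    (s := {w | w ∈ monitored G k S i ∧ (closedNbhd G w \ monitored G k S i).ncard ≤ k}) ⟨hv, hk⟩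

theorem exists_closedNbhd_subset_monitored (G : SimpleGraph V) (k : ℕ) (S : Set V) {i : ℕ} {x : V}
    (hx : x ∈ monitored G k S i) :
    ∃ v, x ∈ closedNbhd G v ∧ closedNbhd G v ⊆ monitored G k S i := by
  cases i with
  | zero =>
    obtain ⟨v, hv, hxv⟩ := Set.mem_iUnion₂.1 hx
    exact ⟨v, hxv, closedNbhd_subset_monitored_zero G k hv⟩
  | succ i =>
    obtain ⟨v, hv, hxv⟩ := Set.mem_iUnion₂.1 hx
    exact ⟨v, hxv, closedNbhd_subset_monitored_succ G k hv.1 hv.2⟩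

theorem monitored_mono (G : SimpleGraph V) (k : ℕ) (S : Set V) : Monotone (monitored G k S) := by
  refine monotone_nat_of_le_succ fun i x hx => ?_
  obtain ⟨v, hxv, hv⟩ := exists_closedNbhd_subset_monitored G k S hx
  refine closedNbhd_subset_monitored_succ G k (hv (self_mem_closedNbhd G v)) ?_ hxv
  simp [Set.sdiff_eq_empty.2 hv]

theorem subset_monitored (G : SimpleGraph V) (k : ℕ) (S : Set V) (i : ℕ) :
    S ⊆ monitored G k S i :=
  (subset_monitored_zero G k S).trans (monitored_mono G k S i.zero_le)

theorem exists_isPDS_ncard_eq_pdn (G : SimpleGraph V) (k : ℕ) :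
    ∃ S : Set V, IsPDS G k S ∧ S.ncard = pdn G k :=
  Nat.sInf_mem (s := {n | ∃ S : Set V, IsPDS G k S ∧ S.ncard = n}) ⟨_, _, isPDS_univ G k, rfl⟩

theorem IsPDS.pdn_le {G : SimpleGraph V} {k : ℕ} {S : Set V} (hS : IsPDS G k S) :
    pdn G k ≤ S.ncard :=
  Nat.sInf_le ⟨S, hS, rfl⟩

theorem closedNbhd_deleteEdges_subset (G : SimpleGraph V) (s : Set (Sym2 V)) (w : V) :
    closedNbhd (G.deleteEdges s) w ⊆ closedNbhd G w :=
  Set.insert_subset_insert fun _ h => (deleteEdges_adj.1 h).1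

theorem mem_closedNbhd_deleteEdges {G : SimpleGraph V} {u v w x : V} (hx : x ∈ closedNbhd G w) :
    x ∈ closedNbhd (G.deleteEdges {s(u, v)}) w ∨ w = u ∧ x = v ∨ w = v ∧ x = u := by
  rcases hx with rfl | hx
  · exact Or.inl (self_mem_closedNbhd _ _)
  · by_cases h : s(w, x) = s(u, v)
    · exact Or.inr (Sym2.eq_iff.1 h)
    · exact Or.inl (Or.inr (deleteEdges_adj.2 ⟨hx, h⟩))

/-- If `u` is monitored no later than `v`, then adding `v` to `S` makes up for the loss of the
edge `uv`. -/
theorem monitored_subset_monitored_deleteEdges [Finite V] (G : SimpleGraph V) (k : ℕ) {S : Set V}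
    {u v : V} (hS : v ∈ S → u ∈ S)
    (hP : ∀ i, v ∈ monitored G k S i → u ∈ monitored G k S i) (i : ℕ) :
    monitored G k S i ⊆ monitored (G.deleteEdges {s(u, v)}) k (insert v S) i := by
  induction i with
  | zero =>
    intro x hx
    obtain ⟨w, hw, hxw⟩ := Set.mem_iUnion₂.1 hx
    rcases mem_closedNbhd_deleteEdges (u := u) (v := v) hxw with h | ⟨-, rfl⟩ | ⟨rfl, rfl⟩
    · exact closedNbhd_subset_monitored_zero _ k (Set.mem_insert_of_mem v hw) h
    · exact subset_monitored_zero _ k _ (Set.mem_insert x S)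
    · exact subset_monitored_zero _ k _ (Set.mem_insert_of_mem w (hS hw))
  | succ i ih =>
    intro x hx
    obtain ⟨w, ⟨hw, hwk⟩, hxw⟩ := Set.mem_iUnion₂.1 hx
    rcases mem_closedNbhd_deleteEdges (u := u) (v := v) hxw with h | ⟨-, rfl⟩ | ⟨rfl, rfl⟩
    · refine closedNbhd_subset_monitored_succ _ k (ih hw) (le_trans ?_ hwk) h
      exact Set.ncard_le_ncard
        (Set.sdiff_subset_sdiff (closedNbhd_deleteEdges_subset G _ w) ih) (Set.toFinite _)
    · exact subset_monitored _ k _ _ (Set.mem_insert x S)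
    · exact monitored_mono _ k _ i.le_succ (ih (hP i hw))

theorem monitored_order_total (G : SimpleGraph V) (k : ℕ) (S : Set V) (u v : V) :
    ((v ∈ S → u ∈ S) ∧ ∀ i, v ∈ monitored G k S i → u ∈ monitored G k S i) ∨
      ((u ∈ S → v ∈ S) ∧ ∀ i, u ∈ monitored G k S i → v ∈ monitored G k S i) := by
  by_cases hu : u ∈ S
  · exact Or.inl ⟨fun _ => hu, fun i _ => subset_monitored G k S i hu⟩
  by_cases hv : v ∈ S
  · exact Or.inr ⟨fun _ => hv, fun i _ => subset_monitored G k S i hv⟩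
  by_cases h : ∀ i, v ∈ monitored G k S i → u ∈ monitored G k S i
  · exact Or.inl ⟨fun h' => absurd h' hv, h⟩
  push Not at h
  obtain ⟨i, hvi, hui⟩ := h
  refine Or.inr ⟨fun h' => absurd h' hu, fun j huj => ?_⟩
  rcases le_total i j with hij | hji
  · exact monitored_mono G k S hij hvi
  · exact absurd (monitored_mono G k S hji huj) hui

theorem IsPDS.exists_insert_deleteEdges [Finite V] {G : SimpleGraph V} {k : ℕ} {S : Set V}
    (hS : IsPDS G k S) (e : Sym2 V) : ∃ w, IsPDS (G.deleteEdges {e}) k (insert w S) := by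
  induction e with | _ u v
  obtain ⟨i, hi⟩ := hS
  rcases monitored_order_total G k S u v with ⟨h, hP⟩ | ⟨h, hP⟩
  · exact ⟨v, i, Set.univ_subset_iff.1 (hi ▸ monitored_subset_monitored_deleteEdges G k h hP i)⟩
  · rw [Sym2.eq_swap]
    exact ⟨u, i, Set.univ_subset_iff.1 (hi ▸ monitored_subset_monitored_deleteEdges G k h hP i)⟩

theorem pdn_edge_deletion_upper {V : Type*} [Fintype V]
    (G : SimpleGraph V) (k : ℕ) (hk : 0 < k) (e : Sym2 V) (he : e ∈ G.edgeSet) :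
    pdn (G.deleteEdges {e}) k ≤ pdn G k + 1 := by
  obtain ⟨S, hS, hn⟩ := exists_isPDS_ncard_eq_pdn G k
  obtain ⟨w, hw⟩ := hS.exists_insert_deleteEdges e
  exact hw.pdn_le.trans (hn ▸ Set.ncard_insert_le w S)
end

section
/- If G is a finite simple graph that is a disjoint union of k-generalized spiders (a forest in which every connected component contains at most one vertex of degree at least k + 2), where k is a positive integer, then γ_{P,k}(G) equals the number of connected components of G. -/
open SimpleGraph

variable {V : Type*}

theorem mem_closedNbhd {G : SimpleGraph V} {v w : V} :
    w ∈ closedNbhd G v ↔ w = v ∨ G.Adj v w := by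
  simp [closedNbhd]

theorem reachable_of_mem_closedNbhd {G : SimpleGraph V} {v w : V} (h : w ∈ closedNbhd G v) :
    G.Reachable v w := by
  rcases mem_closedNbhd.1 h with rfl | h
  · rfl
  · exact h.reachable

theorem exists_reachable_of_mem_monitored {G : SimpleGraph V} {k : ℕ} {S : Set V} {i : ℕ}
    {v : V} (h : v ∈ monitored G k S i) : ∃ s ∈ S, G.Reachable s v := by
  induction i generalizing v with
  | zero =>
    simp only [monitored, closedNbhdSet, Set.mem_iUnion] at h
    obtain ⟨s, hs, hv⟩ := h
    exact ⟨s, hs, reachable_of_mem_closedNbhd hv⟩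
  | succ i ih =>
    simp only [monitored, Set.mem_iUnion] at h
    obtain ⟨w, ⟨hw, -⟩, hv⟩ := h
    obtain ⟨s, hs, hsw⟩ := ih hw
    exact ⟨s, hs, hsw.trans (reachable_of_mem_closedNbhd hv)⟩

theorem IsPDS.card_connectedComponent_le [Finite V] {G : SimpleGraph V} {k : ℕ} {S : Set V}
    (h : IsPDS G k S) : Nat.card G.ConnectedComponent ≤ S.ncard := by
  obtain ⟨i, hi⟩ := h
  rw [← Nat.card_coe_set_eq]
  refine Nat.card_le_card_of_surjective (fun s : S => G.connectedComponentMk s) fun c => ?_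
  induction c using ConnectedComponent.ind with
  | h v =>
    have hv : v ∈ monitored G k S i := hi ▸ Set.mem_univ v
    obtain ⟨s, hs, hsv⟩ := exists_reachable_of_mem_monitored hv
    exact ⟨⟨s, hs⟩, ConnectedComponent.sound hsv⟩

/-- If every vertex of degree at least `k + 2` in the component of `r ∈ S` is `r` itself, then
step `i` monitors all vertices within distance `i + 1` of `r`. -/
theorem mem_monitored_of_walk [Finite V] {G : SimpleGraph V} {k : ℕ} {S : Set V} {r : V}
    (hr : r ∈ S) (hdeg : ∀ v, G.Reachable v r → k + 2 ≤ (G.neighborSet v).ncard → v = r)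
    (i : ℕ) {v : V} (p : G.Walk v r) (hp : p.length ≤ i + 1) : v ∈ monitored G k S i := by
  induction i generalizing v with
  | zero =>
    simp only [monitored, closedNbhdSet, Set.mem_iUnion]
    refine ⟨r, hr, mem_closedNbhd.2 ?_⟩
    cases p with
    | nil => exact .inl rfl
    | cons h q =>
      have hq : q.length = 0 := by simpa using hp
      exact .inr (Walk.eq_of_length_eq_zero hq ▸ h).symm
  | succ i ih =>
    have hroot : (closedNbhd G r \ monitored G k S i).ncard ≤ k := by
      have hsub : closedNbhd G r ⊆ monitored G k S i := fun x hx => by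
        rcases mem_closedNbhd.1 hx with rfl | hx
        · exact ih .nil (by simp)
        · exact ih (.cons hx.symm .nil) (by simp)
      simp [Set.sdiff_eq_empty.2 hsub]
    simp only [monitored, Set.mem_iUnion]
    cases p with
    | nil => exact ⟨r, ⟨ih .nil (by simp), hroot⟩, mem_closedNbhd.2 (.inl rfl)⟩
    | @cons _ w _ h q =>
      have hq : q.length ≤ i + 1 := by simpa using hp
      have hw := ih q hq
      refine ⟨w, ⟨hw, ?_⟩, mem_closedNbhd.2 (.inr h.symm)⟩
      by_cases hwr : w = r
      · exact hwr ▸ hroot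
      have hlt : (G.neighborSet w).ncard < k + 2 := by
        by_contra! hle
        exact hwr (hdeg w q.reachable hle)
      cases q with
      | nil => exact absurd rfl hwr
      | @cons _ u _ hwu q' =>
        have hq' : q'.length ≤ i := by simpa using hq
        have hu := ih q' (by omega)
        have hsub : closedNbhd G w \ monitored G k S i ⊆ G.neighborSet w \ {u} := by
          rintro x ⟨hx, hxm⟩
          rcases mem_closedNbhd.1 hx with rfl | hx
          · exact absurd hw hxm
          · exact ⟨hx, fun hxu => hxm (hxu ▸ hu)⟩
        have hle := Set.ncard_le_ncard hsub
        rw [Set.ncard_sdiff_singleton_of_mem (show u ∈ G.neighborSet w from hwu)] at hle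
        omega

theorem exists_root_of_unique_large_degree {G : SimpleGraph V} {d : ℕ}
    (h : ∀ u v : V, G.Reachable u v →
      d ≤ (G.neighborSet u).ncard → d ≤ (G.neighborSet v).ncard → u = v)
    (c : G.ConnectedComponent) :
    ∃ r, G.connectedComponentMk r = c ∧
      ∀ v, G.Reachable v r → d ≤ (G.neighborSet v).ncard → v = r := by
  by_cases hc : ∃ r, G.connectedComponentMk r = c ∧ d ≤ (G.neighborSet r).ncard
  · obtain ⟨r, hrc, hr⟩ := hc
    exact ⟨r, hrc, fun v hvr hv => h v r hvr hv hr⟩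
  · obtain ⟨r, rfl⟩ := c.exists_rep
    exact ⟨r, rfl, fun v hvr hv => absurd ⟨v, ConnectedComponent.sound hvr, hv⟩ hc⟩

theorem pdn_of_union_of_spiders {V : Type*} [Fintype V]
    (G : SimpleGraph V) (k : ℕ) (hk : 0 < k)
    (hforest : G.IsAcyclic)
    (hspider : ∀ u v : V, G.Reachable u v →
      k + 2 ≤ (G.neighborSet u).ncard → k + 2 ≤ (G.neighborSet v).ncard → u = v) :
    pdn G k = Nat.card G.ConnectedComponent := by
  choose r hrc hr using exists_root_of_unique_large_degree hspider
  have hpds : IsPDS G k (Set.range r) := by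
    refine ⟨Fintype.card V, Set.eq_univ_of_forall fun v => ?_⟩
    obtain ⟨p, hp⟩ := (ConnectedComponent.exact
      (hrc (G.connectedComponentMk v)).symm).exists_isPath
    exact mem_monitored_of_walk (Set.mem_range_self _) (hr _) _ p (by have := hp.length_lt; omega)
  have hcard : (Set.range r).ncard = Nat.card G.ConnectedComponent := by
    rw [← Nat.card_coe_set_eq]
    exact Nat.card_range_of_injective (Function.LeftInverse.injective hrc)
  refine le_antisymm (Nat.sInf_le ⟨_, hpds, hcard⟩) ?_
  obtain ⟨S, hS, hSn⟩ := Nat.sInf_mem (s := {n | ∃ S : Set V, IsPDS G k S ∧ S.ncard = n})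
    ⟨_, _, hpds, rfl⟩
  exact hS.card_connectedComponent_le.trans_eq hSn
end

section
/- Let k be a positive integer, a ≥ 1, and G = K_a □ K_a the Cartesian product of two complete graphs on a vertices. Then γ_{P,k}(G) = a − k if a ≥ k + 2, and γ_{P,k}(G) = 1 otherwise. -/
open SimpleGraph

variable {V : Type*}

theorem mem_closedNbhd_boxProd_top {α β : Type*} (p q : α × β) :
    q ∈ closedNbhd ((⊤ : SimpleGraph α) □ (⊤ : SimpleGraph β)) p ↔ q.1 = p.1 ∨ q.2 = p.2 := by
  obtain ⟨x, y⟩ := p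
  obtain ⟨z, w⟩ := q
  simp only [closedNbhd, Set.mem_insert_iff, mem_neighborSet, boxProd_adj, top_adj, Prod.mk.injEq]
  grind

theorem mem_closedNbhdSet_boxProd_top {α β : Type*} (S : Set (α × β)) (q : α × β) :
    q ∈ closedNbhdSet ((⊤ : SimpleGraph α) □ (⊤ : SimpleGraph β)) S ↔
      q.1 ∈ Prod.fst '' S ∨ q.2 ∈ Prod.snd '' S := by
  simp only [closedNbhdSet, Set.mem_iUnion, mem_closedNbhd_boxProd_top, Set.mem_image, exists_prop]
  grind

theorem monitored_empty (G : SimpleGraph V) (k i : ℕ) : monitored G k ∅ i = ∅ := by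
  induction i with
  | zero => simp [monitored, closedNbhdSet]
  | succ i ih => simp [monitored, ih]

theorem not_isPDS_empty [Nonempty V] (G : SimpleGraph V) (k : ℕ) : ¬ IsPDS G k ∅ := by
  rintro ⟨i, hi⟩
  rw [monitored_empty] at hi
  exact Set.empty_ne_univ hi

/-- If a set misses more than `k` rows and more than `k` columns, the vertices lying in a missed row
and in a missed column are never monitored. -/
theorem monitored_boxProd_top_subset {α β : Type*} [Finite α] [Finite β] {k : ℕ}
    {S : Set (α × β)} (hr : k < (Prod.fst '' S)ᶜ.ncard) (hc : k < (Prod.snd '' S)ᶜ.ncard) (i : ℕ) :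
    monitored ((⊤ : SimpleGraph α) □ (⊤ : SimpleGraph β)) k S i ⊆
      ((Prod.fst '' S)ᶜ ×ˢ (Prod.snd '' S)ᶜ)ᶜ := by
  induction i with
  | zero =>
    intro q hq
    rw [monitored, mem_closedNbhdSet_boxProd_top] at hq
    simp only [Set.mem_compl_iff, Set.mem_prod]
    tauto
  | succ i ih =>
    intro q hq hqU
    simp only [monitored, Set.mem_iUnion, Set.mem_ofPred_eq, exists_prop] at hq
    obtain ⟨p, ⟨-, hcard⟩, hqp⟩ := hq
    have key : ∀ T ⊆ closedNbhd ((⊤ : SimpleGraph α) □ (⊤ : SimpleGraph β)) p,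
        T ⊆ (Prod.fst '' S)ᶜ ×ˢ (Prod.snd '' S)ᶜ → T.ncard ≤ k := fun T hT hTU =>
      le_trans (Set.ncard_le_ncard (Set.subset_sdiff.2 ⟨hT, Set.disjoint_left.2 fun _ ht h =>
        ih h (hTU ht)⟩) (Set.toFinite _)) hcard
    rcases (mem_closedNbhd_boxProd_top p q).1 hqp with h | h
    · refine hc.not_ge ?_
      rw [← Set.ncard_image_of_injective _ (Prod.mk_right_injective q.1)]
      apply key
      · rintro _ ⟨t, -, rfl⟩
        exact (mem_closedNbhd_boxProd_top _ _).2 (Or.inl h)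
      · rintro _ ⟨t, ht, rfl⟩
        exact ⟨hqU.1, ht⟩
    · refine hr.not_ge ?_
      rw [← Set.ncard_image_of_injective _ (Prod.mk_left_injective q.2)]
      apply key
      · rintro _ ⟨t, -, rfl⟩
        exact (mem_closedNbhd_boxProd_top _ _).2 (Or.inr h)
      · rintro _ ⟨t, ht, rfl⟩
        exact ⟨ht, hqU.2⟩

theorem IsPDS.le_ncard_add {a k : ℕ} {S : Set (Fin a × Fin a)}
    (hS : IsPDS ((⊤ : SimpleGraph (Fin a)) □ (⊤ : SimpleGraph (Fin a))) k S) :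
    a ≤ S.ncard + k := by
  by_contra! hlt
  have hcard (f : Fin a × Fin a → Fin a) : k < (f '' S)ᶜ.ncard := by
    have h := Set.ncard_add_ncard_compl (f '' S)
    have h' := Set.ncard_image_le (f := f) S.toFinite
    rw [Nat.card_fin] at h
    omega
  obtain ⟨i, hi⟩ := hS
  obtain ⟨x, hx⟩ := Set.nonempty_of_ncard_ne_zero (Nat.ne_zero_of_lt (hcard Prod.fst))
  obtain ⟨y, hy⟩ := Set.nonempty_of_ncard_ne_zero (Nat.ne_zero_of_lt (hcard Prod.snd))
  exact monitored_boxProd_top_subset (hcard Prod.fst) (hcard Prod.snd) i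
    (hi ▸ Set.mem_univ (x, y)) ⟨hx, hy⟩

/-- The first `m` vertices of the diagonal form a `k`-power dominating set as soon as at most `k`
rows are missed. -/
theorem isPDS_diagonal {a k m : ℕ} (hm : 0 < m) (hma : m ≤ a) (hk : a ≤ m + k) :
    IsPDS ((⊤ : SimpleGraph (Fin a)) □ (⊤ : SimpleGraph (Fin a))) k
      (Set.range fun i : Fin m => (Fin.castLE hma i, Fin.castLE hma i)) := by
  set S := Set.range fun i : Fin m => (Fin.castLE hma i, Fin.castLE hma i) with hS
  have hfst : Prod.fst '' S = Set.range (Fin.castLE hma) := by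
    rw [hS, ← Set.range_comp]; rfl
  have hsnd : Prod.snd '' S = Set.range (Fin.castLE hma) := by
    rw [hS, ← Set.range_comp]; rfl
  have hmem (q : Fin a × Fin a) :
      q ∈ monitored ((⊤ : SimpleGraph (Fin a)) □ (⊤ : SimpleGraph (Fin a))) k S 0 ↔
        q.1 ∈ Set.range (Fin.castLE hma) ∨ q.2 ∈ Set.range (Fin.castLE hma) := by
    rw [monitored, mem_closedNbhdSet_boxProd_top, hfst, hsnd]
  have hcompl : (Set.range (Fin.castLE hma))ᶜ.ncard ≤ k := by
    have h := Set.ncard_add_ncard_compl (Set.range (Fin.castLE hma))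
    rw [Set.ncard_range_of_injective (Fin.castLE_injective hma), Nat.card_fin, Nat.card_fin] at h
    omega
  refine ⟨1, Set.eq_univ_of_forall fun q => ?_⟩
  rw [monitored]
  simp only [Set.mem_iUnion, Set.mem_ofPred_eq, exists_prop]
  refine ⟨(q.1, Fin.castLE hma ⟨0, hm⟩), ⟨(hmem _).2 (Or.inr ⟨_, rfl⟩), ?_⟩,
    (mem_closedNbhd_boxProd_top _ _).2 (Or.inl rfl)⟩
  refine le_trans ?_ hcompl
  rw [← Set.ncard_image_of_injective (Set.range (Fin.castLE hma))ᶜ (Prod.mk_right_injective q.1)]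
  refine Set.ncard_le_ncard ?_ (Set.toFinite _)
  rintro ⟨x, y⟩ ⟨hu, hn⟩
  rw [hmem, not_or] at hn
  rcases (mem_closedNbhd_boxProd_top _ _).1 hu with rfl | rfl
  · exact ⟨y, hn.2, rfl⟩
  · exact absurd ⟨_, rfl⟩ hn.2

theorem ncard_diagonal {a m : ℕ} (hma : m ≤ a) :
    (Set.range fun i : Fin m => (Fin.castLE hma i, Fin.castLE hma i)).ncard = m := by
  rw [Set.ncard_range_of_injective, Nat.card_fin]
  intro i j h
  exact Fin.castLE_injective hma (Prod.ext_iff.1 h).1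

theorem pdn_boxProd_complete (k a : ℕ) (hk : 0 < k) (ha : 1 ≤ a) :
    pdn ((⊤ : SimpleGraph (Fin a)) □ (⊤ : SimpleGraph (Fin a))) k =
      if k + 2 ≤ a then a - k else 1 := by
  have : NeZero a := ⟨by omega⟩
  have hm : 0 < (if k + 2 ≤ a then a - k else 1) ∧ (if k + 2 ≤ a then a - k else 1) ≤ a ∧
      a ≤ (if k + 2 ≤ a then a - k else 1) + k := by
    split_ifs <;> omega
  refine IsLeast.csInf_eq ⟨⟨_, isPDS_diagonal hm.1 hm.2.1 hm.2.2, ncard_diagonal _⟩, ?_⟩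
  rintro _ ⟨S, hS, rfl⟩
  have hle := hS.le_ncard_add
  have hpos : S.ncard ≠ 0 := fun h =>
    not_isPDS_empty _ k ((Set.ncard_eq_zero S.toFinite).1 h ▸ hS)
  split_ifs <;> omega
end

section
/- Let k be a positive integer, a ≥ k + 2, and G = K_a □ K_a the Cartesian product of two complete graphs on a vertices. Then γ_{P,k}(G/e) = a − k − 1 for every edge e of G, where G/e is the contraction of the edge e in G. -/
open SimpleGraph

variable {V : Type*}

/-- The contraction `G/e` of the edge `e = xy`: delete `x` and `y` and replace them by a
new vertex (represented by `x`) adjacent to all vertices in `(N_G(x) ∪ N_G(y)) \ {x, y}`. -/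
def contractEdge (G : SimpleGraph V) (x y : V) : SimpleGraph {u : V // u ≠ y} :=
  SimpleGraph.fromRel (fun a b =>
    ((a : V) = x ∧ (G.Adj x b ∨ G.Adj y b)) ∨ ((a : V) ≠ x ∧ (b : V) ≠ x ∧ G.Adj a b))

/-- Coordinates identifying `G` with the rook's graph `K_a □ K_a`. -/
structure RookCoords (G : SimpleGraph V) (a : ℕ) where
  row : V → Fin a
  col : V → Fin a
  cell : Fin a → Fin a → V
  row_cell : ∀ i j, row (cell i j) = i
  col_cell : ∀ i j, col (cell i j) = j
  cell_row_col : ∀ u, cell (row u) (col u) = u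
  adj_iff : ∀ u w, G.Adj u w ↔ u ≠ w ∧ (row u = row w ∨ col u = col w)

namespace RookCoords

variable {G : SimpleGraph V} {a k : ℕ} {x y : V}

theorem ext (c : RookCoords G a) {u w : V} (hr : c.row u = c.row w) (hc : c.col u = c.col w) :
    u = w := by
  rw [← c.cell_row_col u, ← c.cell_row_col w, hr, hc]

theorem mem_closedNbhd_contracted (c : RookCoords G a) (h : x ≠ y) (hr : c.row x = c.row y)
    (w : {u : V // u ≠ y}) :
    w ∈ closedNbhd (contractEdge G x y) ⟨x, h⟩ ↔
      c.row w = c.row x ∨ c.col w = c.col x ∨ c.col w = c.col y := by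
  obtain ⟨w, hw⟩ := w
  simp only [closedNbhd, contractEdge, Set.mem_insert_iff, mem_neighborSet, fromRel_adj,
    c.adj_iff, Subtype.mk.injEq, ne_eq]
  grind

theorem mem_closedNbhd_of_ne (c : RookCoords G a)
    {u : {u : V // u ≠ y}} (w : {u : V // u ≠ y}) (hu : (u : V) ≠ x) (hw : (w : V) ≠ x) :
    w ∈ closedNbhd (contractEdge G x y) u ↔ c.row w = c.row u ∨ c.col w = c.col u := by
  obtain ⟨w, hwy⟩ := w
  obtain ⟨u, huy⟩ := u
  simp only [closedNbhd, contractEdge, Set.mem_insert_iff, mem_neighborSet, fromRel_adj,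
    c.adj_iff, Subtype.mk.injEq, ne_eq]
  grind

theorem mem_closedNbhd_comm {H : SimpleGraph V} {u w : V} :
    u ∈ closedNbhd H w ↔ w ∈ closedNbhd H u := by
  simp only [closedNbhd, Set.mem_insert_iff, mem_neighborSet, H.adj_comm u w, eq_comm]

/-- Rows containing no vertex of `S`. -/
def freeRows (c : RookCoords G a) (S : Set {u : V // u ≠ y}) : Set (Fin a) :=
  {i | ∀ s ∈ S, c.row s ≠ i}

/-- Columns containing no vertex of `S`, where the contracted vertex lies in both columns. -/
def freeCols (c : RookCoords G a) (x : V) (S : Set {u : V // u ≠ y}) : Set (Fin a) :=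
  {j | ∀ s ∈ S, c.col s ≠ j ∧ ((s : V) = x → c.col y ≠ j)}

theorem mem_closedNbhdSet_iff (c : RookCoords G a) (h : x ≠ y) (hr : c.row x = c.row y)
    (S : Set {u : V // u ≠ y}) (u : {u : V // u ≠ y}) (hu : (u : V) ≠ x) :
    u ∈ closedNbhdSet (contractEdge G x y) S ↔
      c.row u ∉ c.freeRows S ∨ c.col u ∉ c.freeCols x S := by
  have key : ∀ s : {u : V // u ≠ y}, u ∈ closedNbhd (contractEdge G x y) s ↔
      c.row s = c.row u ∨ c.col s = c.col u ∨ ((s : V) = x ∧ c.col y = c.col u) := by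
    rintro ⟨s, hs⟩
    by_cases hsx : s = x
    · subst hsx
      rw [c.mem_closedNbhd_contracted h hr]
      grind
    · rw [c.mem_closedNbhd_of_ne u hsx hu]
      grind
  simp only [closedNbhdSet, Set.mem_iUnion, key, freeRows, freeCols, Set.mem_ofPred_eq]
  grind

theorem contracted_mem_closedNbhdSet_iff (c : RookCoords G a) (h : x ≠ y)
    (hr : c.row x = c.row y) (S : Set {u : V // u ≠ y}) :
    (⟨x, h⟩ : {u : V // u ≠ y}) ∈ closedNbhdSet (contractEdge G x y) S ↔
      c.row x ∉ c.freeRows S ∨ c.col x ∉ c.freeCols x S ∨ c.col y ∉ c.freeCols x S := by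
  simp only [closedNbhdSet, Set.mem_iUnion, mem_closedNbhd_comm (u := (⟨x, h⟩ : {u : V // u ≠ y})),
    c.mem_closedNbhd_contracted h hr, freeRows, freeCols, Set.mem_ofPred_eq]
  grind

theorem le_ncard_freeRows (c : RookCoords G a) [Finite V] (S : Set {u : V // u ≠ y}) :
    a ≤ (c.freeRows S).ncard + S.ncard := by
  have hcompl : (c.freeRows S)ᶜ = (fun s : {u : V // u ≠ y} => c.row s) '' S := by
    ext i
    simp [freeRows]
  have hadd := Set.ncard_add_ncard_compl (c.freeRows S)
  have hle := Set.ncard_image_le (f := fun s : {u : V // u ≠ y} => c.row s) S.toFinite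
  rw [← hcompl] at hle
  simp only [Nat.card_eq_fintype_card, Fintype.card_fin] at hadd
  omega

theorem le_ncard_freeCols (c : RookCoords G a) [Finite V]
    (S : Set {u : V // u ≠ y}) :
    a ≤ (c.freeCols x S).ncard + S.ncard + 1 := by
  have hcompl : (c.freeCols x S)ᶜ ⊆
      insert (c.col y) ((fun s : {u : V // u ≠ y} => c.col s) '' S) := by
    intro j hj
    simp only [freeCols, Set.mem_compl_iff, Set.mem_ofPred_eq, not_forall] at hj
    obtain ⟨s, hs, hj⟩ := hj
    simp only [Set.mem_insert_iff, Set.mem_image]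
    grind
  have hadd := Set.ncard_add_ncard_compl (c.freeCols x S)
  have hle := Set.ncard_image_le (f := fun s : {u : V // u ≠ y} => c.col s) S.toFinite
  have hins := Set.ncard_insert_le (c.col y) ((fun s : {u : V // u ≠ y} => c.col s) '' S)
  have hsub := Set.ncard_le_ncard hcompl
  simp only [Nat.card_eq_fintype_card, Fintype.card_fin] at hadd
  omega

theorem le_ncard_freeCols_of_row_mem (c : RookCoords G a) [Finite V]
    (S : Set {u : V // u ≠ y}) (hx : c.row x ∈ c.freeRows S) :
    a ≤ (c.freeCols x S).ncard + S.ncard := by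
  have hcompl : (c.freeCols x S)ᶜ ⊆ (fun s : {u : V // u ≠ y} => c.col s) '' S := by
    intro j hj
    simp only [freeCols, Set.mem_compl_iff, Set.mem_ofPred_eq, not_forall] at hj
    obtain ⟨s, hs, hj⟩ := hj
    simp only [Set.mem_image]
    simp only [freeRows, Set.mem_ofPred_eq] at hx
    grind
  have hadd := Set.ncard_add_ncard_compl (c.freeCols x S)
  have hle := Set.ncard_image_le (f := fun s : {u : V // u ≠ y} => c.col s) S.toFinite
  have hsub := Set.ncard_le_ncard hcompl
  simp only [Nat.card_eq_fintype_card, Fintype.card_fin] at hadd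
  omega

theorem le_ncard_of_subset_image {α β : Type*} [Finite α] {f : α → β} {T : Set β} {B : Set α}
    (hT : T ⊆ f '' B) : T.ncard ≤ B.ncard :=
  (Set.ncard_le_ncard hT (B.toFinite.image f)).trans (Set.ncard_image_le B.toFinite)

theorem lt_ncard_of_diff_subset_image {α β : Type*} [Finite α] {f : α → β} {T : Set β}
    {B : Set α} {t : β} (hk : k + 2 ≤ T.ncard) (hT : T \ {t} ⊆ f '' B) : k < B.ncard := by
  have := Set.pred_ncard_le_ncard_sdiff_singleton T t
  have := le_ncard_of_subset_image hT
  omega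

/-- If few vertices are selected, every monitored vertex with a neighbour outside the
closed neighbourhood of the selection has more than `k` of them. -/
theorem lt_ncard_closedNbhd_diff (c : RookCoords G a) [Finite V] (h : x ≠ y)
    (hr : c.row x = c.row y) (S : Set {u : V // u ≠ y}) (hS : S.ncard + k + 2 ≤ a)
    {w z : {u : V // u ≠ y}} (hw : w ∈ closedNbhdSet (contractEdge G x y) S)
    (hzw : z ∈ closedNbhd (contractEdge G x y) w)
    (hz : z ∉ closedNbhdSet (contractEdge G x y) S) :
    k < (closedNbhd (contractEdge G x y) w \ closedNbhdSet (contractEdge G x y) S).ncard := by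
  set M := closedNbhdSet (contractEdge G x y) S with hM
  have hrows := c.le_ncard_freeRows S
  have hcols := c.le_ncard_freeCols (x := x) S
  have hcols' := c.le_ncard_freeCols_of_row_mem (x := x) S
  have hcell : ∀ i ∈ c.freeRows S, ∀ j ∈ c.freeCols x S, ∀ hx : c.cell i j ≠ x,
      ∀ hy : c.cell i j ≠ y,
      (((w : V) ≠ x ∧ (i = c.row w ∨ j = c.col w)) ∨
        ((w : V) = x ∧ (i = c.row x ∨ j = c.col x ∨ j = c.col y))) →
      (⟨c.cell i j, hy⟩ : {u : V // u ≠ y}) ∈ closedNbhd (contractEdge G x y) w \ M := by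
    intro i hi j hj hx hy hadj
    refine ⟨?_, ?_⟩
    · rcases hadj with ⟨hwx, hadj⟩ | ⟨hwx, hadj⟩
      · rw [c.mem_closedNbhd_of_ne _ hwx hx]
        simpa [c.row_cell, c.col_cell] using hadj
      · obtain ⟨w, hwy⟩ := w
        subst hwx
        rw [c.mem_closedNbhd_contracted h hr]
        simpa [c.row_cell, c.col_cell] using hadj
    · rw [hM, c.mem_closedNbhdSet_iff h hr S _ hx]
      simp [c.row_cell, c.col_cell, hi, hj]
  have hrowne : ∀ i j, i ≠ c.row x → c.cell i j ≠ x ∧ c.cell i j ≠ y := by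
    intro i j hi
    refine ⟨fun e => hi ?_, fun e => hi ?_⟩
    · rw [← e, c.row_cell]
    · rw [hr, ← e, c.row_cell]
  have hcolx : ∀ i j, j ≠ c.col x → c.cell i j ≠ x := by
    rintro i j hj rfl
    exact hj (c.col_cell i j).symm
  have hcoly : ∀ i j, j ≠ c.col y → c.cell i j ≠ y := by
    rintro i j hj rfl
    exact hj (c.col_cell i j).symm
  have byCol : ∀ j ∈ c.freeCols x S,
      (((w : V) ≠ x ∧ j = c.col w) ∨ ((w : V) = x ∧ (j = c.col x ∨ j = c.col y))) →
      k < (closedNbhd (contractEdge G x y) w \ M).ncard := by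
    intro j hj hadj
    refine lt_ncard_of_diff_subset_image (f := fun u : {u : V // u ≠ y} => c.row u)
      (T := c.freeRows S) (t := c.row x) (by omega) ?_
    rintro i ⟨hi, hix⟩
    obtain ⟨hx, hy⟩ := hrowne i j hix
    exact ⟨⟨c.cell i j, hy⟩, hcell i hi j hj hx hy (by tauto), c.row_cell i j⟩
  have byRow : c.row w ∈ c.freeRows S → c.row w = c.row x →
      ∀ t, (∀ j ∈ c.freeCols x S, j ≠ t → j ≠ c.col x ∧ j ≠ c.col y) →
      k < (closedNbhd (contractEdge G x y) w \ M).ncard := by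
    intro hi hix t ht
    have := hcols' (hix ▸ hi)
    refine lt_ncard_of_diff_subset_image (f := fun u : {u : V // u ≠ y} => c.col u)
      (T := c.freeCols x S) (t := t) (by omega) ?_
    rintro j ⟨hj, hjt⟩
    obtain ⟨hjx, hjy⟩ := ht j hj hjt
    exact ⟨⟨c.cell (c.row w) j, hcoly _ _ hjy⟩,
      hcell _ hi j hj (hcolx _ _ hjx) _ (by tauto), c.col_cell _ j⟩
  have byRow_of_mem : c.row w = c.row x → c.row w ∈ c.freeRows S →
      (c.col x ∉ c.freeCols x S ∨ c.col y ∉ c.freeCols x S) →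
      k < (closedNbhd (contractEdge G x y) w \ M).ncard := by
    intro hix hi hxy
    rcases hxy with hx | hy
    · exact byRow hi hix (c.col y) fun j hj hjt => ⟨fun e => hx (e ▸ hj), hjt⟩
    · exact byRow hi hix (c.col x) fun j hj hjt => ⟨hjt, fun e => hy (e ▸ hj)⟩
  have hxM := c.contracted_mem_closedNbhdSet_iff h hr S
  have hzM := fun hzx : (z : V) ≠ x => (c.mem_closedNbhdSet_iff h hr S z hzx).not.mp hz
  by_cases hwx : (w : V) = x
  · have hwx' : w = ⟨x, h⟩ := Subtype.ext hwx
    subst hwx'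
    by_cases hxR : c.row x ∈ c.freeRows S
    · exact byRow_of_mem rfl hxR ((hxM.mp hw).resolve_left (not_not.mpr hxR))
    · have hzx : (z : V) ≠ x := fun e => hz (by rwa [show z = ⟨x, h⟩ from Subtype.ext e])
      have hzM' := hzM hzx
      push Not at hzM'
      rw [c.mem_closedNbhd_contracted h hr] at hzw
      refine byCol _ hzM'.2 (Or.inr ⟨rfl, hzw.resolve_left fun e => hxR (e ▸ hzM'.1)⟩)
  · have hwM := (c.mem_closedNbhdSet_iff h hr S w hwx).mp hw
    have hxw := c.mem_closedNbhd_contracted h hr w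
    rw [mem_closedNbhd_comm] at hxw
    by_cases hwR : c.row w ∈ c.freeRows S
    · have hwC := hwM.resolve_left (not_not.mpr hwR)
      by_cases hwr : c.row w = c.row x
      · by_cases hx : (⟨x, h⟩ : {u : V // u ≠ y}) ∈ M
        · exact byRow_of_mem hwr hwR
            ((hxM.mp hx).resolve_left (not_not.mpr (hwr ▸ hwR)))
        · have := hcols' (hwr ▸ hwR)
          refine lt_ncard_of_diff_subset_image (f := fun u : {u : V // u ≠ y} => c.col u)
            (T := c.freeCols x S) (t := c.col y) (by omega) ?_
          rintro j ⟨hj, hjy⟩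
          by_cases hjx : j = c.col x
          · exact ⟨⟨x, h⟩, ⟨hxw.mpr (Or.inl hwr), hx⟩, hjx.symm⟩
          · exact ⟨⟨c.cell (c.row w) j, hcoly _ _ hjy⟩,
              hcell _ hwR j hj (hcolx _ _ hjx) _ (Or.inl ⟨hwx, Or.inl rfl⟩), c.col_cell _ j⟩
      · refine lt_of_lt_of_le (by omega : k < (c.freeCols x S).ncard)
          (le_ncard_of_subset_image (f := fun u : {u : V // u ≠ y} => c.col u) ?_)
        intro j hj
        obtain ⟨hx, hy⟩ := hrowne (c.row w) j hwr
        exact ⟨⟨c.cell (c.row w) j, hy⟩, hcell _ hwR j hj hx hy (Or.inl ⟨hwx, Or.inl rfl⟩), c.col_cell _ j⟩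
    · refine byCol (c.col w) ?_ (Or.inl ⟨hwx, rfl⟩)
      by_cases hzx : (z : V) = x
      · have hzx' : z = ⟨x, h⟩ := Subtype.ext hzx
        subst hzx'
        have hx := hxM.not.mp hz
        push Not at hx
        rcases hxw.mp hzw with e | e | e
        · exact absurd (e ▸ hx.1) hwR
        · exact e ▸ hx.2.1
        · exact e ▸ hx.2.2
      · have hzM' := hzM hzx
        push Not at hzM'
        rw [c.mem_closedNbhd_of_ne z hwx hzx] at hzw
        rcases hzw with e | e
        · exact absurd (e ▸ hzM'.1) hwR
        · exact e ▸ hzM'.2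

theorem not_isPDS_of_ncard_le (c : RookCoords G a) [Finite V] (h : x ≠ y)
    (hr : c.row x = c.row y) (S : Set {u : V // u ≠ y}) (hS : S.ncard + k + 2 ≤ a) :
    ¬ IsPDS (contractEdge G x y) k S := by
  have hstuck : ∀ i, monitored (contractEdge G x y) k S i ⊆
      closedNbhdSet (contractEdge G x y) S := by
    intro i
    induction i with
    | zero => exact subset_rfl
    | succ i ih =>
      intro z hz
      simp only [monitored, Set.mem_iUnion, Set.mem_ofPred_eq] at hz
      obtain ⟨w, ⟨hw, hk⟩, hzw⟩ := hz
      by_contra hzM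
      have hlt := c.lt_ncard_closedNbhd_diff h hr S hS (ih hw) hzw hzM
      have hle := Set.ncard_le_ncard (Set.sdiff_subset_sdiff_right ih :
        closedNbhd (contractEdge G x y) w \ closedNbhdSet (contractEdge G x y) S ⊆ _)
      omega
  rintro ⟨i, hi⟩
  have hrows := c.le_ncard_freeRows S
  have hcols := c.le_ncard_freeCols (x := x) S
  obtain ⟨r, hrR, hrx⟩ := Set.exists_ne_of_one_lt_ncard (by omega : 1 < (c.freeRows S).ncard)
    (c.row x)
  obtain ⟨j, hj⟩ := Set.nonempty_of_ncard_ne_zero (by omega : (c.freeCols x S).ncard ≠ 0)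
  have hy : c.cell r j ≠ y := fun e => hrx (by rw [hr, ← e, c.row_cell])
  have hx : c.cell r j ≠ x := fun e => hrx (by rw [← e, c.row_cell])
  have hmem := hstuck i (hi ▸ Set.mem_univ (⟨c.cell r j, hy⟩ : {u : V // u ≠ y}))
  rw [c.mem_closedNbhdSet_iff h hr S _ hx] at hmem
  simp [c.row_cell, c.col_cell, hrR, hj] at hmem

theorem exists_isPDS (c : RookCoords G a) [Finite V] (h : x ≠ y)
    (hr : c.row x = c.row y) (hk : k + 2 ≤ a) :
    ∃ S : Set {u : V // u ≠ y}, IsPDS (contractEdge G x y) k S ∧ S.ncard = a - k - 1 := by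
  have hcol : c.col x ≠ c.col y := fun e => h (c.ext hr e)
  obtain ⟨T, hxT, hTy, hT⟩ := Finset.exists_subsuperset_card_eq
    (s := {c.col x}) (t := Finset.univ.erase (c.col y)) (n := a - k - 1)
    (by simpa using hcol) (by simp; omega) (by simp; omega)
  have hyT : c.col y ∉ T := fun hy => by simpa using hTy hy
  have hxT : c.col x ∈ T := by simpa using hxT
  set S : Set {u : V // u ≠ y} := {s | c.row s = c.row x ∧ c.col s ∈ T}
  have hcell : ∀ i j, j ≠ c.col y → c.cell i j ≠ y := by
    rintro i j hj rfl
    exact hj (c.col_cell i j).symm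
  have hxS : (⟨x, h⟩ : {u : V // u ≠ y}) ∈ S := ⟨rfl, hxT⟩
  have hcols : c.freeCols x S = ((insert (c.col y) T)ᶜ : Finset (Fin a)) := by
    ext j
    simp only [freeCols, Set.mem_ofPred_eq, Finset.coe_compl, Set.mem_compl_iff,
      Finset.mem_coe, Finset.mem_insert, not_or]
    constructor
    · intro hj
      refine ⟨fun e => (hj _ hxS).2 rfl e.symm, fun hjT => ?_⟩
      have hy := hcell (c.row x) j (fun e => hyT (e ▸ hjT))
      exact (hj ⟨_, hy⟩ ⟨c.row_cell _ _, by simpa [c.col_cell] using hjT⟩).1 (c.col_cell _ _)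
    · rintro ⟨hjy, hjT⟩ s hs
      exact ⟨fun e => hjT (e ▸ hs.2), fun _ => Ne.symm hjy⟩
  refine ⟨S, ⟨1, ?_⟩, ?_⟩
  · set M := closedNbhdSet (contractEdge G x y) S with hM
    have hxN : closedNbhd (contractEdge G x y) ⟨x, h⟩ ⊆ M :=
      Set.subset_biUnion_of_mem (u := closedNbhd (contractEdge G x y)) hxS
    rw [Set.eq_univ_iff_forall]
    intro u
    simp only [monitored, Set.mem_iUnion, Set.mem_ofPred_eq]
    by_cases hux : c.row u = c.row x
    · refine ⟨⟨x, h⟩, ⟨hxN (Or.inl rfl), ?_⟩,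
        (c.mem_closedNbhd_contracted h hr u).mpr (Or.inl hux)⟩
      rw [← hM, Set.sdiff_eq_empty.mpr hxN]
      simp
    · have hwx : c.cell (c.row u) (c.col x) ≠ x := fun e => hux (by rw [← e, c.row_cell])
      have hux' : (u : V) ≠ x := fun e => hux (by rw [e])
      have hwN := hxN ((c.mem_closedNbhd_contracted h hr
        ⟨_, hcell (c.row u) (c.col x) hcol⟩).mpr (Or.inr (Or.inl (c.col_cell _ _))))
      refine ⟨⟨_, hcell (c.row u) (c.col x) hcol⟩, ⟨hwN, ?_⟩,
        (c.mem_closedNbhd_of_ne u hwx hux').mpr (Or.inl (c.row_cell _ _).symm)⟩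
      have hcard : (c.freeCols x S).ncard = k := by
        rw [hcols, Set.ncard_coe_finset, Finset.card_compl, Finset.card_insert_of_notMem hyT, hT]
        simp
        omega
      rw [← hcard, ← hM]
      have hmem : ∀ z ∈ closedNbhd (contractEdge G x y)
          ⟨_, hcell (c.row u) (c.col x) hcol⟩ \ M,
          c.row z = c.row u ∧ c.col z ∈ c.freeCols x S := by
        rintro z ⟨hzw, hz⟩
        have hzN := fun hzx => hz (hxN hzx)
        rw [c.mem_closedNbhd_contracted h hr] at hzN
        have hzx : (z : V) ≠ x := fun e => hzN (by simp [e])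
        rw [c.mem_closedNbhd_of_ne z hwx hzx] at hzw
        simp only [c.row_cell, c.col_cell] at hzw
        rw [hM, c.mem_closedNbhdSet_iff h hr S z hzx] at hz
        push Not at hz
        exact ⟨hzw.resolve_right fun e => hzN (Or.inr (Or.inl e)), hz.2⟩
      refine Set.ncard_le_ncard_of_injOn (fun z => c.col z) (fun z hz => (hmem z hz).2) ?_
      intro z hz w hw e
      exact Subtype.ext (c.ext ((hmem z hz).1.trans (hmem w hw).1.symm) e)
  · rw [← hT, ← Set.ncard_coe_finset]
    refine Set.ncard_congr (fun s _ => c.col s) (fun s hs => hs.2) ?_ ?_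
    · intro s t hs ht e
      exact Subtype.ext (c.ext (hs.1.trans ht.1.symm) e)
    · intro j hj
      have hy := hcell (c.row x) j (fun e => hyT (e ▸ hj))
      exact ⟨⟨_, hy⟩, ⟨c.row_cell _ _, by simpa [c.col_cell] using hj⟩, c.col_cell _ _⟩

theorem pdn_contractEdge (c : RookCoords G a) [Finite V] (h : x ≠ y)
    (hr : c.row x = c.row y) (hk : k + 2 ≤ a) :
    pdn (contractEdge G x y) k = a - k - 1 := by
  have hex := c.exists_isPDS h hr hk
  refine le_antisymm (Nat.sInf_le hex) (le_csInf ⟨_, hex⟩ ?_)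
  rintro n ⟨S, hS, rfl⟩
  by_contra hlt
  exact c.not_isPDS_of_ncard_le h hr S (by omega) hS

/-- The standard coordinates of `K_a □ K_a`. -/
def ofBoxProd (a : ℕ) : RookCoords ((⊤ : SimpleGraph (Fin a)) □ (⊤ : SimpleGraph (Fin a))) a where
  row := Prod.fst
  col := Prod.snd
  cell := Prod.mk
  row_cell _ _ := rfl
  col_cell _ _ := rfl
  cell_row_col _ := rfl
  adj_iff u w := by
    simp only [boxProd_adj, top_adj, ne_eq, Prod.ext_iff]
    tauto

/-- Exchanging rows and columns. -/
def swap (c : RookCoords G a) : RookCoords G a where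
  row := c.col
  col := c.row
  cell i j := c.cell j i
  row_cell i j := c.col_cell j i
  col_cell i j := c.row_cell j i
  cell_row_col := c.cell_row_col
  adj_iff u w := by rw [c.adj_iff, or_comm]

end RookCoords

theorem pdn_boxProd_complete_edge_contraction (k a : ℕ) (hk : 0 < k) (ha : k + 2 ≤ a)
    (x y : Fin a × Fin a)
    (hxy : ((⊤ : SimpleGraph (Fin a)) □ (⊤ : SimpleGraph (Fin a))).Adj x y) :
    pdn (contractEdge ((⊤ : SimpleGraph (Fin a)) □ (⊤ : SimpleGraph (Fin a))) x y) k =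
      a - k - 1 := by
  obtain ⟨hne, hr | hc⟩ := ((RookCoords.ofBoxProd a).adj_iff x y).mp hxy
  · exact (RookCoords.ofBoxProd a).pdn_contractEdge hne hr ha
  · exact (RookCoords.ofBoxProd a).swap.pdn_contractEdge hne hc ha
end
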